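/- Let p₁(·), p₂(·) : ℝⁿ → [1,∞) be measurable exponents with pⱼ(·) ∈ LH for j = 1,2, and define p(·) by 1/p(x) = 1/p₁(x) + 1/p₂(x). Then the vector condition G⃗ holds: there is a constant C such that for every family 𝒬 of pairwise disjoint cubes and all functions f₁ ∈ L^{p₁(·)}, f₂ ∈ L^{p₂(·)}, h ∈ L^{p'(·)}, Σ_{Q∈𝒬} ‖f₁χ_Q‖_{p₁(·)}‖f₂χ_Q‖_{p₂(·)}‖hχ_Q‖_{p'(·)} ≤ C‖f₁‖_{p₁(·)}‖f₂‖_{p₂(·)}‖h‖_{p'(·)}. -/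

import Mathlib

open MeasureTheory ENNReal Set

noncomputable section

/-- Euclidean space `ℝⁿ`. -/
abbrev Rn (n : ℕ) : Type := Fin n → ℝ

/-- A cube in `ℝⁿ` with sides parallel to the coordinate axes. -/
structure Cube (n : ℕ) : Type where
  base : Fin n → ℝ
  side : ℝ
  side_pos : 0 < side

namespace Cube

/-- The set of points of a cube. -/
def toSet {n : ℕ} (Q : Cube n) : Set (Rn n) :=
  {x | ∀ i, Q.base i ≤ x i ∧ x i < Q.base i + Q.side}

/-- The volume `|Q|` of a cube. -/
def vol {n : ℕ} (Q : Cube n) : ℝ≥0∞ := ENNReal.ofReal (Q.side ^ n)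

/-- Membership in the standard dyadic grid `𝒟₀`. -/
def IsDyadic {n : ℕ} (Q : Cube n) : Prop :=
  ∃ (k : ℤ) (j : Fin n → ℤ), Q.side = (2 : ℝ) ^ (-k) ∧
    ∀ i, Q.base i = (2 : ℝ) ^ (-k) * (j i : ℝ)

end Cube

/-- The modular associated to an extended-real-valued exponent `r(·)`:
`ρ(f/λ) = ∫_{r ≠ ∞} (f/λ)^{r(x)} dμ + ‖f/λ‖_{L^∞({r = ∞})}`. -/
def eModular {n : ℕ} (r : Rn n → ℝ≥0∞) (μ : Measure (Rn n)) (f : Rn n → ℝ≥0∞)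
    (lam : ℝ≥0∞) : ℝ≥0∞ :=
  (∫⁻ x in {x | r x ≠ ∞}, (f x / lam) ^ (r x).toReal ∂μ)
    + essSup (fun x => f x / lam) (μ.restrict {x | r x = ∞})

/-- The variable Lebesgue (quasi)norm `‖f‖_{r(·)}` with respect to a measure `μ`. -/
def eNorm {n : ℕ} (r : Rn n → ℝ≥0∞) (μ : Measure (Rn n)) (f : Rn n → ℝ≥0∞) : ℝ≥0∞ :=
  sInf {lam : ℝ≥0∞ | lam ≠ 0 ∧ eModular r μ f lam ≤ 1}

/-- The variable Lebesgue norm of a real-valued function with respect to Lebesgue measure. -/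
def vNorm {n : ℕ} (r : Rn n → ℝ≥0∞) (f : Rn n → ℝ) : ℝ≥0∞ :=
  eNorm r volume fun x => ENNReal.ofReal |f x|

/-- View a real-valued exponent as an extended-real-valued one. -/
def ofExp {n : ℕ} (p : Rn n → ℝ) : Rn n → ℝ≥0∞ := fun x => ENNReal.ofReal (p x)

/-- The conjugate of an extended real exponent: `1/t + 1/t' = 1`. -/
def econj (t : ℝ≥0∞) : ℝ≥0∞ :=
  if t = 1 then ∞ else if t = ∞ then 1 else ENNReal.ofReal (t.toReal / (t.toReal - 1))

/-- The pointwise conjugate exponent `p'(·)` of a real-valued exponent. -/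
def conjExp {n : ℕ} (p : Rn n → ℝ) : Rn n → ℝ≥0∞ := fun x => econj (ENNReal.ofReal (p x))

/-- A weight: a measurable function that is positive (and finite) a.e. -/
def IsWeight {n : ℕ} (w : Rn n → ℝ) : Prop :=
  Measurable w ∧ ∀ᵐ x ∂(volume : Measure (Rn n)), 0 < w x

/-- Local log-Hölder continuity `LH₀`. -/
def LH0 {n : ℕ} (p : Rn n → ℝ) : Prop :=
  ∃ C₀ > 0, ∀ x y : Rn n, dist x y < 1 / 2 →
    |1 / p x - 1 / p y| ≤ C₀ / (-Real.log (dist x y))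

/-- Log-Hölder continuity at infinity with a given asymptotic value `pinf`. -/
def LHinfWith {n : ℕ} (p : Rn n → ℝ) (pinf : ℝ) : Prop :=
  ∃ C > 0, ∀ x : Rn n, |1 / p x - 1 / pinf| ≤ C / Real.log (Real.exp 1 + ‖x‖)

/-- Log-Hölder continuity at infinity `LH∞`. -/
def LHinf {n : ℕ} (p : Rn n → ℝ) : Prop := ∃ pinf > 0, LHinfWith p pinf

/-- Log-Hölder continuity `LH = LH₀ ∩ LH∞`. -/
def LH {n : ℕ} (p : Rn n → ℝ) : Prop := LH0 p ∧ LHinf p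

/-- The bilinear variable Muckenhoupt condition `(w₁,w₂,w) ∈ A_{p⃗(·)}`. -/
def ApVec {n : ℕ} (p₁ p₂ p w₁ w₂ w : Rn n → ℝ) : Prop :=
  ∃ C : ℝ≥0∞, C ≠ ∞ ∧ ∀ Q : Cube n,
    Q.vol⁻¹ ^ 2 * vNorm (ofExp p) (Q.toSet.indicator w) *
      vNorm (conjExp p₁) (Q.toSet.indicator fun x => (w₁ x)⁻¹) *
      vNorm (conjExp p₂) (Q.toSet.indicator fun x => (w₂ x)⁻¹) ≤ C

/-- The variable Muckenhoupt class `A_{r(·)}` for an extended-real-valued exponent. -/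
def ApVarE {n : ℕ} (r : Rn n → ℝ≥0∞) (v : Rn n → ℝ) : Prop :=
  ∃ C : ℝ≥0∞, C ≠ ∞ ∧ ∀ Q : Cube n,
    Q.vol⁻¹ * vNorm r (Q.toSet.indicator v) *
      vNorm (fun x => econj (r x)) (Q.toSet.indicator fun x => (v x)⁻¹) ≤ C

/-- The bilinear maximal operator `M(f₁,f₂)`. -/
def biMax {n : ℕ} (f₁ f₂ : Rn n → ℝ) (x : Rn n) : ℝ≥0∞ :=
  ⨆ (Q : Cube n) (_ : x ∈ Q.toSet),
    (Q.vol⁻¹ * ∫⁻ y in Q.toSet, ENNReal.ofReal |f₁ y|) *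
      (Q.vol⁻¹ * ∫⁻ y in Q.toSet, ENNReal.ofReal |f₂ y|)

/-- The dyadic bilinear maximal operator `M^d(f₁,f₂)`. -/
def biMaxD {n : ℕ} (f₁ f₂ : Rn n → ℝ) (x : Rn n) : ℝ≥0∞ :=
  ⨆ (Q : Cube n) (_ : Q.IsDyadic) (_ : x ∈ Q.toSet),
    (Q.vol⁻¹ * ∫⁻ y in Q.toSet, ENNReal.ofReal |f₁ y|) *
      (Q.vol⁻¹ * ∫⁻ y in Q.toSet, ENNReal.ofReal |f₂ y|)

/-- The bilinear averaging operator `A_Q(f₁,f₂) = (⨍_Q f₁)(⨍_Q f₂)χ_Q`. -/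
def avgOp {n : ℕ} (Q : Cube n) (f₁ f₂ : Rn n → ℝ) (x : Rn n) : ℝ≥0∞ :=
  Q.toSet.indicator
    (fun _ =>
      (Q.vol⁻¹ * ∫⁻ y in Q.toSet, ENNReal.ofReal |f₁ y|) *
        (Q.vol⁻¹ * ∫⁻ y in Q.toSet, ENNReal.ofReal |f₂ y|)) x

/-- `(p)₋(Q)`, the essential infimum of `p` on a cube `Q`. -/
def pMinusOn {n : ℕ} (p : Rn n → ℝ) (Q : Cube n) : ℝ :=
  essInf p (volume.restrict Q.toSet)

/-- The exponent `q(Q)` with `1/q(Q) = 1/(p₁)₋(Q) + 1/(p₂)₋(Q)`. -/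
def qExp {n : ℕ} (p₁ p₂ : Rn n → ℝ) (Q : Cube n) : ℝ :=
  ((pMinusOn p₁ Q)⁻¹ + (pMinusOn p₂ Q)⁻¹)⁻¹

/-- The finite measure on `ℝⁿ` with density `(1 + ‖x‖)^{-(n+1)}`. -/
def tailMeasure (n : ℕ) : Measure (Rn n) :=
  volume.withDensity fun x => ENNReal.ofReal ((1 + ‖x‖) ^ (-((n : ℝ) + 1)))

lemma tailMeasure_univ_ne_top (n : ℕ) : tailMeasure n univ ≠ ∞ := by
  rw [tailMeasure, withDensity_apply _ MeasurableSet.univ, Measure.restrict_univ]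
  exact (finite_integral_one_add_norm (by simp)).ne

namespace Cube

lemma toSet_eq_pi {n : ℕ} (Q : Cube n) :
    Q.toSet = pi univ fun i => Ico (Q.base i) (Q.base i + Q.side) := by
  ext x
  simp [toSet, mem_pi]

lemma measurableSet_toSet {n : ℕ} (Q : Cube n) : MeasurableSet Q.toSet := by
  rw [toSet_eq_pi]
  exact MeasurableSet.univ_pi fun _ => measurableSet_Ico

lemma base_mem_toSet {n : ℕ} (Q : Cube n) : Q.base ∈ Q.toSet :=
  fun _ => ⟨le_rfl, lt_add_of_pos_right _ Q.side_pos⟩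

lemma dist_lt_side {n : ℕ} (Q : Cube n) {x y : Rn n} (hx : x ∈ Q.toSet) (hy : y ∈ Q.toSet) :
    dist x y < Q.side := by
  rw [dist_pi_lt_iff Q.side_pos]
  intro i
  rw [Real.dist_eq, abs_lt]
  constructor <;> linarith [(hx i).1, (hx i).2, (hy i).1, (hy i).2]

/-- A cube contains a subcube of side `min ℓ(Q) 1` within distance one of any of its points. -/
lemma ofReal_le_tailMeasure {n : ℕ} (Q : Cube n) {x : Rn n} (hx : x ∈ Q.toSet) :
    ENNReal.ofReal (min Q.side 1 ^ n * (2 + ‖x‖) ^ (-((n : ℝ) + 1))) ≤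
      tailMeasure n Q.toSet := by
  set l := min Q.side 1 with hl
  have hl0 : 0 < l := lt_min Q.side_pos one_pos
  have hl1 : l ≤ 1 := min_le_right _ _
  have hls : l ≤ Q.side := min_le_left _ _
  set b : Rn n := fun i => min (x i) (Q.base i + Q.side - l) with hb
  set S : Set (Rn n) := pi univ fun i => Ico (b i) (b i + l) with hS
  have hbx : ∀ i, b i ≤ x i ∧ b i ≤ Q.base i + Q.side - l ∧ Q.base i ≤ b i ∧ x i ≤ b i + l := by
    intro i
    refine ⟨min_le_left _ _, min_le_right _ _, le_min (hx i).1 (by linarith), ?_⟩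
    rcases min_choice (x i) (Q.base i + Q.side - l) with h | h <;> simp only [hb, h]
    · linarith
    · linarith [(hx i).2]
  have hSQ : S ⊆ Q.toSet := by
    intro y hy i
    have := hy i (mem_univ i)
    have h2 := hbx i
    exact ⟨h2.2.2.1.trans this.1, by linarith [this.2, h2.2.1]⟩
  have hSm : MeasurableSet S := MeasurableSet.univ_pi fun _ => measurableSet_Ico
  have hSv : volume S = ENNReal.ofReal (l ^ n) := by
    rw [hS, Real.volume_pi_Ico]
    simp [ENNReal.ofReal_pow hl0.le]
  refine le_trans ?_ (measure_mono hSQ)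
  rw [tailMeasure, withDensity_apply _ hSm, ENNReal.ofReal_mul (by positivity), ← hSv, mul_comm,
    ← setLIntegral_const]
  refine setLIntegral_mono' hSm fun y hy => ENNReal.ofReal_le_ofReal ?_
  have hyx : ‖y - x‖ ≤ 1 := by
    rw [pi_norm_le_iff_of_nonneg zero_le_one]
    intro i
    have := hy i (mem_univ i)
    have h2 := hbx i
    rw [Real.norm_eq_abs, abs_le, Pi.sub_apply]
    constructor <;> linarith [this.1, this.2]
  have hy : ‖y‖ ≤ 1 + ‖x‖ := by
    calc ‖y‖ = ‖(y - x) + x‖ := by simp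
      _ ≤ _ := (norm_add_le _ _).trans (by linarith)
  exact Real.rpow_le_rpow_of_nonpos (by positivity) (by linarith)
    (by linarith [(Nat.cast_nonneg n : (0 : ℝ) ≤ n)])

lemma tailMeasure_ne_zero {n : ℕ} (Q : Cube n) : tailMeasure n Q.toSet ≠ 0 := by
  refine (lt_of_lt_of_le ?_ (Q.ofReal_le_tailMeasure Q.base_mem_toSet)).ne'
  have := lt_min Q.side_pos one_pos
  rw [ENNReal.ofReal_pos]
  positivity

end Cube

/-- On a cube, the oscillation of `1/p` compensates the logarithm of any number which is
bounded and at least the tail mass of the cube. -/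
lemma LH.exists_mul_abs_log_le {n : ℕ} {p : Rn n → ℝ} (hp : LH p) {B : ℝ} (hB : 1 ≤ B) :
    ∃ K, ∀ (Q : Cube n) (x y : Rn n), x ∈ Q.toSet → y ∈ Q.toSet → ∀ m : ℝ, 0 < m →
      tailMeasure n Q.toSet ≤ ENNReal.ofReal m → m ≤ B →
        |1 / p x - 1 / p y| * |Real.log m| ≤ K := by
  obtain ⟨⟨C₀, hC₀, h0⟩, pinf, -, C, hC, hinf⟩ := hp
  have hlogB := Real.log_nonneg hB
  refine ⟨2 * C * Real.log B + n * (C₀ + 2 * C) + (n + 1) * (2 * C), ?_⟩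
  intro Q x y hx hy m hm hmQ hmB
  wlog hxy : ‖x‖ ≤ ‖y‖ generalizing x y
  · rw [abs_sub_comm]
    exact this y x hy hx (le_of_not_ge hxy)
  have he : (2 : ℝ) < Real.exp 1 := by linarith [Real.exp_one_gt_d9]
  have hlog : ∀ a : ℝ, 0 ≤ a → 1 ≤ Real.log (Real.exp 1 + a) := by
    intro a ha
    rw [Real.le_log_iff_exp_le (by positivity)]
    linarith
  set D := |1 / p x - 1 / p y| with hD
  have hD0 : 0 ≤ D := abs_nonneg _
  set l := min Q.side 1 with hl
  have hl0 : 0 < l := lt_min Q.side_pos one_pos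
  have hDinf : D * Real.log (Real.exp 1 + ‖x‖) ≤ 2 * C := by
    have h1 := hlog _ (norm_nonneg x)
    have hy' : |1 / p y - 1 / pinf| ≤ C / Real.log (Real.exp 1 + ‖x‖) := by
      refine (hinf y).trans ?_
      gcongr
    have : D ≤ C / Real.log (Real.exp 1 + ‖x‖) + C / Real.log (Real.exp 1 + ‖x‖) := by
      have h3 := abs_sub_le (1 / p x) (1 / pinf) (1 / p y)
      rw [abs_sub_comm (1 / pinf)] at h3
      linarith [hinf x]
    rw [← add_div, le_div_iff₀ (by linarith)] at this
    linarith
  have hD2 : D ≤ 2 * C :=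
    (le_mul_of_one_le_right hD0 (hlog _ (norm_nonneg x))).trans hDinf
  have hDx : D * Real.log (2 + ‖x‖) ≤ 2 * C := by
    refine le_trans ?_ hDinf
    gcongr
  have hDl : D * (-Real.log l) ≤ C₀ + 2 * C := by
    rcases lt_or_ge Q.side (1 / 2) with hs | hs
    · have hls : l = Q.side := min_eq_left (by linarith)
      have hlogl : Real.log l < 0 := by
        rw [hls]
        exact Real.log_neg Q.side_pos (by linarith)
      rcases eq_or_ne x y with rfl | hne
      · have : D = 0 := by simp [hD]
        rw [this]
        linarith
      have hd := Q.dist_lt_side hx hy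
      have hd0 : 0 < dist x y := dist_pos.2 hne
      have hlogd : Real.log (dist x y) ≤ Real.log l := by
        rw [hls]
        exact Real.log_le_log hd0 hd.le
      have h1 := h0 x y (hd.trans hs)
      rw [le_div_iff₀ (by linarith)] at h1
      have : D * (-Real.log l) ≤ D * (-Real.log (dist x y)) := by gcongr
      linarith
    · have hhalf : (1 / 2 : ℝ) ≤ l := le_min hs (by norm_num)
      have h2 : -Real.log l ≤ 1 := by
        have := Real.log_le_log (by norm_num) hhalf
        rw [one_div, Real.log_inv] at this
        linarith [Real.log_two_lt_d9]
      have : D * (-Real.log l) ≤ D * 1 := by gcongr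
      linarith
  have hlow : n * Real.log l - (n + 1) * Real.log (2 + ‖x‖) ≤ Real.log m := by
    have h1 := (ENNReal.ofReal_le_ofReal_iff hm.le).1 ((Q.ofReal_le_tailMeasure hx).trans hmQ)
    have h2 := Real.log_le_log (by positivity) h1
    rw [Real.log_mul (by positivity) (by positivity), Real.log_pow,
      Real.log_rpow (by positivity)] at h2
    linarith
  have hll : Real.log l ≤ 0 := Real.log_nonpos hl0.le (min_le_right _ _)
  have hlx : 0 ≤ Real.log (2 + ‖x‖) := Real.log_nonneg (by linarith [norm_nonneg x])
  have hup : Real.log m ≤ Real.log B := Real.log_le_log hm hmB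
  have habs : |Real.log m| ≤
      Real.log B + n * (-Real.log l) + (n + 1) * Real.log (2 + ‖x‖) := by
    have h1 : 0 ≤ n * (-Real.log l) := mul_nonneg (Nat.cast_nonneg n) (by linarith)
    have h2 : 0 ≤ (n + 1) * Real.log (2 + ‖x‖) := by positivity
    rw [abs_le]
    constructor <;> linarith
  calc D * |Real.log m|
      ≤ D * (Real.log B + n * (-Real.log l) + (n + 1) * Real.log (2 + ‖x‖)) := by gcongr
    _ = D * Real.log B + n * (D * (-Real.log l)) + (n + 1) * (D * Real.log (2 + ‖x‖)) := by ring
    _ ≤ _ := by gcongr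

/-- The exponent `r` vanishes on `E`, and off `E` it is the reciprocal of `s`, where
`0 ≤ s ≤ 1`. -/
structure IsReciprocalOff {n : ℕ} (E : Set (Rn n)) (r : Rn n → ℝ≥0∞) (s : Rn n → ℝ) : Prop where
  measurableSet : MeasurableSet E
  measurable : Measurable r
  eq_zero : ∀ x ∈ E, r x = 0
  eq_inv : ∀ x ∉ E, r x = (ENNReal.ofReal (s x))⁻¹
  nonneg : ∀ x, 0 ≤ s x
  le_one : ∀ x, s x ≤ 1

lemma div_rpow_mul_le {f lam a m M : ℝ≥0∞} {s : ℝ} (ha0 : a ≠ 0) (ha1 : a ≤ 1)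
    (hm0 : m ≠ 0) (hm : m ≠ ∞) (hM : m ^ s ≤ M) :
    f / (a⁻¹ * M * lam) ≤ a * (m ^ s)⁻¹ * (f / lam) := by
  have ha : a ≠ ∞ := ne_top_of_le_ne_top one_ne_top ha1
  have hms0 : m ^ s ≠ 0 := (ENNReal.rpow_pos (pos_iff_ne_zero.2 hm0) hm).ne'
  have hms : m ^ s ≠ ∞ := ENNReal.rpow_ne_top_of_ne_zero hm0 hm
  calc f / (a⁻¹ * M * lam) ≤ f / (a⁻¹ * m ^ s * lam) := by gcongr
    _ = a * (m ^ s)⁻¹ * (f / lam) := by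
      rw [div_eq_mul_inv, div_eq_mul_inv, ENNReal.mul_inv, ENNReal.mul_inv, inv_inv]
      · ring
      · exact Or.inl (ENNReal.inv_ne_zero.2 ha)
      · exact Or.inl (ENNReal.inv_ne_top.2 ha0)
      · exact Or.inl (mul_ne_zero (ENNReal.inv_ne_zero.2 ha) hms0)
      · exact Or.inl (ENNReal.mul_ne_top (ENNReal.inv_ne_top.2 ha0) hms)

/-- The norm of the restriction of `F` to a set `S` is controlled by the power `m ^ σ`, provided
`m` dominates the modular of `F` on `S` and `m ^ s(x)` is comparable to `m ^ σ` on `S`. -/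
lemma IsReciprocalOff.eNorm_indicator_le {n : ℕ} {E S : Set (Rn n)} {r : Rn n → ℝ≥0∞}
    {s : Rn n → ℝ} (hr : IsReciprocalOff E r s) (hS : MeasurableSet S)
    {a κ m lam : ℝ≥0∞} {σ : ℝ} (ha0 : a ≠ 0) (haE : volume E + 2 * a ≤ 1) (hκ0 : κ ≠ 0)
    (hm0 : m ≠ 0) (hm : m ≠ ∞) (hosc : ∀ x ∈ S, m ^ s x ≤ κ * m ^ σ)
    {F : Rn n → ℝ≥0∞} (hlam0 : lam ≠ 0) (hF : eModular r volume F lam ≤ 1)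
    (hmF : ∫⁻ x in S, (F x / lam) ^ (r x).toReal ∂(volume.restrict {x | r x ≠ ∞}) ≤ m) :
    eNorm r volume (S.indicator F) ≤ a⁻¹ * (κ * m ^ σ) * lam := by
  have ha2 : 2 * a ≤ 1 := le_add_self.trans haE
  have ha1 : a ≤ 1 := (le_mul_of_one_le_left' one_le_two).trans ha2
  have ha : a ≠ ∞ := ne_top_of_le_ne_top one_ne_top ha1
  have hmσ0 : m ^ σ ≠ 0 := (ENNReal.rpow_pos (pos_iff_ne_zero.2 hm0) hm).ne'
  refine sInf_le ⟨mul_ne_zero (mul_ne_zero (ENNReal.inv_ne_zero.2 ha)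
    (mul_ne_zero hκ0 hmσ0)) hlam0, ?_⟩
  set L := a⁻¹ * (κ * m ^ σ) * lam with hL
  have hL' : ∀ x ∈ S, F x / L ≤ a * (m ^ s x)⁻¹ * (F x / lam) := fun x hx =>
    div_rpow_mul_le ha0 ha1 hm0 hm (hosc x hx)
  have hfin : MeasurableSet {x | r x ≠ ∞} := hr.measurable (measurableSet_singleton ∞).compl
  have htop : MeasurableSet {x | r x = ∞} := hr.measurable (measurableSet_singleton ∞)
  have hpt : ∀ x, r x ≠ ∞ → (S.indicator F x / L) ^ (r x).toReal ≤ E.indicator 1 x +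
      S.indicator (fun x => a * m⁻¹ * (F x / lam) ^ (r x).toReal) x := by
    intro x hx
    by_cases hxE : x ∈ E
    · simp [hr.eq_zero x hxE, indicator_of_mem hxE]
    have hs0 : 0 < s x := by
      refine lt_of_le_of_ne (hr.nonneg x) fun h => hx ?_
      rw [hr.eq_inv x hxE, ← h]
      simp
    have hrs : (r x).toReal = (s x)⁻¹ := by
      rw [hr.eq_inv x hxE, ENNReal.toReal_inv, ENNReal.toReal_ofReal hs0.le]
    by_cases hxS : x ∈ S
    · rw [indicator_of_mem hxS, indicator_of_mem hxS, hrs]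
      refine le_add_left ?_
      have h1 : 1 ≤ (s x)⁻¹ := (one_le_inv₀ hs0).2 (hr.le_one x)
      calc (F x / L) ^ (s x)⁻¹ ≤ (a * (m ^ s x)⁻¹ * (F x / lam)) ^ (s x)⁻¹ := by
            gcongr
            exact hL' x hxS
        _ = a ^ (s x)⁻¹ * m⁻¹ * (F x / lam) ^ (s x)⁻¹ := by
            rw [ENNReal.mul_rpow_of_nonneg _ _ (by positivity),
              ENNReal.mul_rpow_of_nonneg _ _ (by positivity), ENNReal.inv_rpow,
              ENNReal.rpow_rpow_inv hs0.ne']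
        _ ≤ a * m⁻¹ * (F x / lam) ^ (s x)⁻¹ := by
            gcongr
            exact ENNReal.rpow_le_self_of_le_one ha1 h1
    · simp [indicator_of_notMem hxS, hrs, hs0]
  have hint : ∫⁻ x in {x | r x ≠ ∞}, (S.indicator F x / L) ^ (r x).toReal ≤ volume E + a := by
    calc ∫⁻ x in {x | r x ≠ ∞}, (S.indicator F x / L) ^ (r x).toReal
        ≤ ∫⁻ x in {x | r x ≠ ∞}, (E.indicator 1 x +
            S.indicator (fun x => a * m⁻¹ * (F x / lam) ^ (r x).toReal) x) :=
          setLIntegral_mono' hfin hpt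
      _ = volume.restrict {x | r x ≠ ∞} E +
          a * m⁻¹ * ∫⁻ x in S, (F x / lam) ^ (r x).toReal ∂(volume.restrict {x | r x ≠ ∞}) := by
          rw [lintegral_add_left (measurable_one.indicator hr.measurableSet),
            lintegral_indicator_one hr.measurableSet, lintegral_indicator hS,
            lintegral_const_mul' _ _ (ENNReal.mul_ne_top ha (ENNReal.inv_ne_top.2 hm0))]
      _ ≤ volume E + a * m⁻¹ * m := by
          gcongr
          exact Measure.restrict_le_self
      _ = volume E + a := by rw [mul_assoc, ENNReal.inv_mul_cancel hm0 hm, mul_one]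
  have hsup : essSup (fun x => S.indicator F x / L) (volume.restrict {x | r x = ∞}) ≤ a := by
    have hF' : essSup (fun x => F x / lam) (volume.restrict {x | r x = ∞}) ≤ 1 :=
      le_add_self.trans hF
    refine essSup_le_of_ae_le _ ?_
    filter_upwards [ENNReal.ae_le_essSup fun x => F x / lam, ae_restrict_mem htop] with x h1 h2
    by_cases hxS : x ∈ S
    · have hxE : x ∉ E := fun h => by
        have := hr.eq_zero x h
        simp_all
      have hs0 : s x = 0 := by
        have := hr.eq_inv x hxE
        rw [show r x = ∞ from h2, eq_comm, ENNReal.inv_eq_top, ENNReal.ofReal_eq_zero] at this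
        exact le_antisymm this (hr.nonneg x)
      rw [indicator_of_mem hxS]
      calc F x / L ≤ a * (m ^ s x)⁻¹ * (F x / lam) := hL' x hxS
        _ = a * (F x / lam) := by simp [hs0]
        _ ≤ a * 1 := by gcongr; exact h1.trans hF'
        _ = a := mul_one a
    · simp [indicator_of_notMem hxS]
  calc _ ≤ (volume E + a) + a := add_le_add hint hsup
    _ = volume E + 2 * a := by ring
    _ ≤ 1 := haE

/-- The oscillation of `s` on a cube compensates logarithms of bounded numbers which are at
least the tail mass of the cube. -/
def HasTailOscillation {n : ℕ} (s : Rn n → ℝ) : Prop :=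
  ∀ B : ℝ, 1 ≤ B → ∃ K : ℝ, ∀ (Q : Cube n) (x y : Rn n), x ∈ Q.toSet → y ∈ Q.toSet →
    ∀ m : ℝ, 0 < m → tailMeasure n Q.toSet ≤ ENNReal.ofReal m → m ≤ B →
      |s x - s y| * |Real.log m| ≤ K

/-- Local norms of functions in the unit ball are controlled by powers of a measure of
bounded mass. -/
lemma IsReciprocalOff.exists_eNorm_indicator_le {n : ℕ} {E : Set (Rn n)} {r : Rn n → ℝ≥0∞}
    {s : Rn n → ℝ} (hr : IsReciprocalOff E r s) (hE : volume E < 1)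
    (hs : HasTailOscillation s) :
    ∃ c : ℝ≥0∞, c ≠ ∞ ∧ ∀ (F : Rn n → ℝ≥0∞) (lam : ℝ≥0∞), lam ≠ 0 →
      eModular r volume F lam ≤ 1 → ∃ τ : Measure (Rn n),
        τ univ ≤ tailMeasure n univ + 1 ∧ (∀ Q : Cube n, τ Q.toSet ≠ 0) ∧
        ∀ Q : Cube n, eNorm r volume (Q.toSet.indicator F) ≤
          c * (τ Q.toSet) ^ s Q.base * lam := by
  have hB : tailMeasure n univ + 1 ≠ ∞ :=
    ENNReal.add_ne_top.2 ⟨tailMeasure_univ_ne_top n, one_ne_top⟩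
  obtain ⟨K, hK⟩ := hs (tailMeasure n univ + 1).toReal
    (by rw [← ENNReal.toReal_one]; exact ENNReal.toReal_mono hB le_add_self)
  set a := (1 - volume E) / 2 with ha
  have ha0 : a ≠ 0 := (ENNReal.half_pos (tsub_pos_of_lt hE).ne').ne'
  have haE : volume E + 2 * a ≤ 1 := by
    rw [ha, ENNReal.mul_div_cancel two_ne_zero ofNat_ne_top, add_tsub_cancel_of_le hE.le]
  refine ⟨a⁻¹ * ENNReal.ofReal (Real.exp K),
    ENNReal.mul_ne_top (ENNReal.inv_ne_top.2 ha0) ofReal_ne_top, fun F lam hlam0 hF => ?_⟩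
  set ν := (volume.restrict {x | r x ≠ ∞}).withDensity fun x => (F x / lam) ^ (r x).toReal
    with hν
  have hν1 : ν univ ≤ 1 := by
    rw [hν, withDensity_apply _ MeasurableSet.univ, Measure.restrict_univ]
    exact le_self_add.trans hF
  have hτ : (tailMeasure n + ν) univ ≤ tailMeasure n univ + 1 := by
    rw [Measure.add_apply]
    gcongr
  have hQ0 : ∀ Q : Cube n, (tailMeasure n + ν) Q.toSet ≠ 0 := fun Q =>
    (lt_of_lt_of_le (pos_iff_ne_zero.2 Q.tailMeasure_ne_zero) le_self_add).ne'
  refine ⟨tailMeasure n + ν, hτ, hQ0, fun Q => ?_⟩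
  have hQB := (measure_mono (subset_univ Q.toSet)).trans hτ
  have hQt : (tailMeasure n + ν) Q.toSet ≠ ∞ := ne_top_of_le_ne_top hB hQB
  rw [mul_assoc a⁻¹]
  refine hr.eNorm_indicator_le Q.measurableSet_toSet ha0 haE
    (ENNReal.ofReal_pos.2 (Real.exp_pos K)).ne' (hQ0 Q) hQt ?_ hlam0 hF ?_
  · intro x hx
    obtain ⟨m, hm⟩ : ∃ m, m = ((tailMeasure n + ν) Q.toSet).toReal := ⟨_, rfl⟩
    have hm0 : 0 < m := hm ▸ ENNReal.toReal_pos (hQ0 Q) hQt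
    have hmQ : (tailMeasure n + ν) Q.toSet = ENNReal.ofReal m := by
      rw [hm, ENNReal.ofReal_toReal hQt]
    have hK' := hK Q x Q.base hx Q.base_mem_toSet m hm0
      (by rw [← hmQ]; exact le_self_add) (hm ▸ ENNReal.toReal_mono hB hQB)
    rw [← abs_mul] at hK'
    rw [hmQ, ENNReal.ofReal_rpow_of_pos hm0, ENNReal.ofReal_rpow_of_pos hm0,
      ← ENNReal.ofReal_mul (Real.exp_pos K).le]
    refine ENNReal.ofReal_le_ofReal ?_
    rw [Real.rpow_def_of_pos hm0, Real.rpow_def_of_pos hm0, ← Real.exp_add]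
    refine Real.exp_le_exp.2 ?_
    linarith [le_abs_self ((s x - s Q.base) * Real.log m)]
  · rw [← withDensity_apply _ Q.measurableSet_toSet]
    exact le_add_self

lemma rpow_mul_rpow_mul_rpow_le {a b c M A : ℝ≥0∞} {s t u : ℝ} (ha : a ≤ M) (hb : b ≤ M)
    (hc : c ≤ M) (hM0 : M ≠ 0) (hMA : M ≤ A) (hA1 : 1 ≤ A) (hA : A ≠ ∞) (hs : 0 ≤ s)
    (ht : 0 ≤ t) (hu : 0 ≤ u) (h1 : 1 ≤ s + t + u) (h2 : s + t + u ≤ 2) :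
    a ^ s * b ^ t * c ^ u ≤ A * M := by
  have hM : M ≠ ∞ := ne_top_of_le_ne_top hA hMA
  calc a ^ s * b ^ t * c ^ u ≤ M ^ s * M ^ t * M ^ u := by gcongr
    _ = M ^ (s + t + u - 1) * M := by
      rw [← ENNReal.rpow_add _ _ hM0 hM, ← ENNReal.rpow_add _ _ hM0 hM]
      nth_rewrite 3 [← ENNReal.rpow_one M]
      rw [← ENNReal.rpow_add _ _ hM0 hM]
      congr 1
      ring
    _ ≤ A ^ (s + t + u - 1) * M := by gcongr
    _ ≤ A ^ (1 : ℝ) * M := by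
      gcongr
      linarith
    _ = A * M := by rw [ENNReal.rpow_one]

/-- An inequality holding for all finite admissible values passes to the infimum. -/
lemma le_mul_sInf_of_forall_le_mul {S : Set ℝ≥0∞} {X a : ℝ≥0∞} (hS : sInf S ≠ ∞) (ha : a ≠ ∞)
    (h : ∀ lam ∈ S, lam ≠ ∞ → X ≤ a * lam) : X ≤ a * sInf S := by
  have hne : S.Nonempty := by
    rw [nonempty_iff_ne_empty]
    rintro rfl
    simp at hS
  obtain ⟨u, -, hu, huS⟩ := exists_seq_tendsto_sInf hne (OrderBot.bddBelow S)
  refine ge_of_tendsto (ENNReal.Tendsto.const_mul hu (Or.inr ha)) ?_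
  filter_upwards [hu.eventually_lt_const (lt_top_iff_ne_top.2 hS)] with k hk
  exact h _ (huS k) hk.ne

lemma Cube.tsum_measure_le {n : ℕ} {𝒬 : Set (Cube n)}
    (h𝒬 : 𝒬.PairwiseDisjoint fun Q => Q.toSet) (τ : Measure (Rn n)) :
    ∑' Q : 𝒬, τ (Q : Cube n).toSet ≤ τ univ :=
  tsum_measure_le_measure_univ (fun Q => Q.1.measurableSet_toSet.nullMeasurableSet)
    fun Q R hQR => (h𝒬 Q.2 R.2 fun h => hQR (Subtype.ext h)).aedisjoint

lemma ofReal_abs_indicator {n : ℕ} (S : Set (Rn n)) (f : Rn n → ℝ) :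
    (fun x => ENNReal.ofReal |S.indicator f x|) = S.indicator fun x => ENNReal.ofReal |f x| := by
  ext x
  by_cases hx : x ∈ S <;> simp [hx]

/-- Summation over disjoint cubes for exponents `1/s₁`, `1/s₂`, `1/s₃` with
`1 ≤ s₁ + s₂ + s₃ ≤ 2`. -/
lemma exists_tsum_vNorm_indicator_le {n : ℕ} {E₁ E₂ E₃ : Set (Rn n)} {r₁ r₂ r₃ : Rn n → ℝ≥0∞}
    {s₁ s₂ s₃ : Rn n → ℝ} (hr₁ : IsReciprocalOff E₁ r₁ s₁) (hr₂ : IsReciprocalOff E₂ r₂ s₂)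
    (hr₃ : IsReciprocalOff E₃ r₃ s₃) (hE₁ : volume E₁ < 1) (hE₂ : volume E₂ < 1)
    (hE₃ : volume E₃ < 1) (hs₁ : HasTailOscillation s₁) (hs₂ : HasTailOscillation s₂)
    (hs₃ : HasTailOscillation s₃) (h1 : ∀ x, 1 ≤ s₁ x + s₂ x + s₃ x)
    (h2 : ∀ x, s₁ x + s₂ x + s₃ x ≤ 2) :
    ∃ C : ℝ≥0∞, C ≠ ∞ ∧ ∀ 𝒬 : Set (Cube n), 𝒬.PairwiseDisjoint (fun Q => Q.toSet) →
      ∀ f₁ f₂ f₃ : Rn n → ℝ, vNorm r₁ f₁ ≠ ∞ → vNorm r₂ f₂ ≠ ∞ → vNorm r₃ f₃ ≠ ∞ →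
        (∑' Q : 𝒬, vNorm r₁ ((Q : Cube n).toSet.indicator f₁) *
          vNorm r₂ ((Q : Cube n).toSet.indicator f₂) *
            vNorm r₃ ((Q : Cube n).toSet.indicator f₃)) ≤
          C * vNorm r₁ f₁ * vNorm r₂ f₂ * vNorm r₃ f₃ := by
  obtain ⟨c₁, hc₁, H₁⟩ := hr₁.exists_eNorm_indicator_le hE₁ hs₁
  obtain ⟨c₂, hc₂, H₂⟩ := hr₂.exists_eNorm_indicator_le hE₂ hs₂
  obtain ⟨c₃, hc₃, H₃⟩ := hr₃.exists_eNorm_indicator_le hE₃ hs₃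
  set A := 3 * (tailMeasure n univ + 1) with hA
  have hAt : A ≠ ∞ := ENNReal.mul_ne_top ofNat_ne_top
    (ENNReal.add_ne_top.2 ⟨tailMeasure_univ_ne_top n, one_ne_top⟩)
  have hA1 : 1 ≤ A := by
    calc (1 : ℝ≥0∞) ≤ 3 * 1 := by norm_num
      _ ≤ A := by
        rw [hA]
        gcongr
        exact le_add_self
  set C := c₁ * c₂ * c₃ * A * A with hC
  have hCt : C ≠ ∞ := by finiteness
  refine ⟨C, hCt, fun 𝒬 h𝒬 f₁ f₂ f₃ hf₁ hf₂ hf₃ => ?_⟩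
  refine le_mul_sInf_of_forall_le_mul hf₃
    (ENNReal.mul_ne_top (ENNReal.mul_ne_top hCt hf₁) hf₂) fun l₃ hl₃ hl₃t => ?_
  rw [mul_right_comm (C * vNorm r₁ f₁)]
  refine le_mul_sInf_of_forall_le_mul hf₂
    (ENNReal.mul_ne_top (ENNReal.mul_ne_top hCt hf₁) hl₃t) fun l₂ hl₂ hl₂t => ?_
  rw [mul_right_comm C, mul_right_comm (C * l₃)]
  refine le_mul_sInf_of_forall_le_mul hf₁
    (ENNReal.mul_ne_top (ENNReal.mul_ne_top hCt hl₃t) hl₂t) fun l₁ hl₁ hl₁t => ?_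
  obtain ⟨τ₁, hτ₁, h0₁, hQ₁⟩ := H₁ _ l₁ hl₁.1 hl₁.2
  obtain ⟨τ₂, hτ₂, h0₂, hQ₂⟩ := H₂ _ l₂ hl₂.1 hl₂.2
  obtain ⟨τ₃, hτ₃, h0₃, hQ₃⟩ := H₃ _ l₃ hl₃.1 hl₃.2
  set τ := τ₁ + τ₂ + τ₃ with hτ
  have hτA : τ univ ≤ A := by
    calc τ univ = τ₁ univ + τ₂ univ + τ₃ univ := rfl
      _ ≤ (tailMeasure n univ + 1) + (tailMeasure n univ + 1) + (tailMeasure n univ + 1) := by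
        gcongr
      _ = A := by rw [hA]; ring
  have hterm : ∀ Q : Cube n, vNorm r₁ (Q.toSet.indicator f₁) * vNorm r₂ (Q.toSet.indicator f₂) *
      vNorm r₃ (Q.toSet.indicator f₃) ≤ c₁ * c₂ * c₃ * A * l₃ * l₂ * l₁ * τ Q.toSet := by
    intro Q
    have hle₁ : τ₁ Q.toSet ≤ τ Q.toSet := le_self_add.trans le_self_add
    have hle₂ : τ₂ Q.toSet ≤ τ Q.toSet := le_add_self.trans le_self_add
    have hle₃ : τ₃ Q.toSet ≤ τ Q.toSet := le_add_self
    have hpow := rpow_mul_rpow_mul_rpow_le hle₁ hle₂ hle₃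
      (fun h => h0₁ Q (le_antisymm (h ▸ hle₁) zero_le))
      ((measure_mono (subset_univ _)).trans hτA) hA1 hAt (hr₁.nonneg Q.base)
      (hr₂.nonneg Q.base) (hr₃.nonneg Q.base) (h1 Q.base) (h2 Q.base)
    simp only [vNorm, ofReal_abs_indicator]
    calc _ ≤ (c₁ * τ₁ Q.toSet ^ s₁ Q.base * l₁) * (c₂ * τ₂ Q.toSet ^ s₂ Q.base * l₂) *
          (c₃ * τ₃ Q.toSet ^ s₃ Q.base * l₃) :=
          mul_le_mul' (mul_le_mul' (hQ₁ Q) (hQ₂ Q)) (hQ₃ Q)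
      _ = c₁ * c₂ * c₃ * l₃ * l₂ * l₁ * (τ₁ Q.toSet ^ s₁ Q.base * τ₂ Q.toSet ^ s₂ Q.base *
          τ₃ Q.toSet ^ s₃ Q.base) := by ring
      _ ≤ c₁ * c₂ * c₃ * l₃ * l₂ * l₁ * (A * τ Q.toSet) := by gcongr
      _ = _ := by ring
  calc _ ≤ ∑' Q : 𝒬, c₁ * c₂ * c₃ * A * l₃ * l₂ * l₁ * τ (Q : Cube n).toSet :=
        ENNReal.tsum_le_tsum fun Q => hterm Q
    _ = c₁ * c₂ * c₃ * A * l₃ * l₂ * l₁ * ∑' Q : 𝒬, τ (Q : Cube n).toSet := ENNReal.tsum_mul_left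
    _ ≤ c₁ * c₂ * c₃ * A * l₃ * l₂ * l₁ * A := by
        gcongr
        exact (Cube.tsum_measure_le h𝒬 τ).trans hτA
    _ = C * l₃ * l₂ * l₁ := by rw [hC]; ring

/-- If `E` has measure at least one, a function of finite norm vanishes off `E`, hence the norms
of its restrictions are zero. -/
lemma IsReciprocalOff.eNorm_indicator_eq_zero {n : ℕ} {E : Set (Rn n)} {r : Rn n → ℝ≥0∞}
    {s : Rn n → ℝ} (hr : IsReciprocalOff E r s) (hE : 1 ≤ volume E) {F : Rn n → ℝ≥0∞}
    (hF : Measurable F) (hnorm : eNorm r volume F ≠ ∞) (S : Set (Rn n)) :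
    eNorm r volume (S.indicator F) = 0 := by
  obtain ⟨lam, ⟨hlam0, hlam⟩, hlamt⟩ := sInf_lt_iff.1 (lt_top_iff_ne_top.2 hnorm)
  have hfin : MeasurableSet {x | r x ≠ ∞} := hr.measurable (measurableSet_singleton ∞).compl
  have hEfin : E ⊆ {x | r x ≠ ∞} := fun x hx => by simp [hr.eq_zero x hx]
  have hmeas : Measurable fun x => (F x / lam) ^ (r x).toReal :=
    (hF.div_const lam).pow hr.measurable.ennreal_toReal
  have hsplit : eModular r volume F lam = volume E +
      ((∫⁻ x in {x | r x ≠ ∞}, Eᶜ.indicator (fun x => (F x / lam) ^ (r x).toReal) x) +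
        essSup (fun x => F x / lam) (volume.restrict {x | r x = ∞})) := by
    rw [eModular, ← add_assoc]
    congr 1
    rw [← Measure.restrict_eq_self volume hEfin, ← lintegral_indicator_one hr.measurableSet,
      ← lintegral_add_left (measurable_one.indicator hr.measurableSet)]
    refine lintegral_congr fun x => ?_
    by_cases hx : x ∈ E <;> simp [hx, hr.eq_zero]
  have hEt : volume E ≠ ∞ := by
    rw [hsplit] at hlam
    exact ne_top_of_le_ne_top one_ne_top (le_self_add.trans hlam)
  have hrest : (∫⁻ x in {x | r x ≠ ∞}, Eᶜ.indicator (fun x => (F x / lam) ^ (r x).toReal) x) +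
      essSup (fun x => F x / lam) (volume.restrict {x | r x = ∞}) = 0 := by
    rw [hsplit] at hlam
    have h := hlam.trans (hE.trans_eq (add_zero _).symm)
    exact le_antisymm ((ENNReal.add_le_add_iff_left hEt).1 h) zero_le
  rw [add_eq_zero, lintegral_eq_zero_iff (hmeas.indicator hr.measurableSet.compl)] at hrest
  have hzero : ∀ᵐ x ∂(volume.restrict {x | r x ≠ ∞}), x ∉ E → F x = 0 := by
    filter_upwards [hrest.1, ae_restrict_mem hfin] with x hx hxr hxE
    rw [indicator_of_mem (by exact hxE), Pi.zero_apply, ENNReal.rpow_eq_zero_iff] at hx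
    rcases hx with ⟨hx, -⟩ | ⟨-, hx⟩
    · simpa [ENNReal.div_eq_zero_iff, hlamt.ne] using hx
    · exact absurd hx (not_lt.2 ENNReal.toReal_nonneg)
  have hzero' : ∀ᵐ x ∂(volume.restrict {x | r x = ∞}), F x = 0 := by
    filter_upwards [ENNReal.ae_le_essSup fun x => F x / lam] with x hx
    rw [hrest.2, nonpos_iff_eq_zero] at hx
    simpa [ENNReal.div_eq_zero_iff, hlamt.ne] using hx
  refine le_antisymm (le_of_forall_gt_imp_ge_of_dense fun L hL => ?_) zero_le
  refine sInf_le ⟨hL.ne', le_trans (add_le_add ?_ ?_) hlam⟩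
  · refine lintegral_mono_ae ?_
    filter_upwards [hzero] with x hx
    by_cases hxE : x ∈ E
    · simp [hr.eq_zero x hxE]
    · have h0 : S.indicator F x = 0 := indicator_apply_eq_zero.2 fun _ => hx hxE
      simp [hx hxE, h0]
  · refine essSup_mono_ae ?_
    filter_upwards [hzero'] with x hx
    simp [hx]

lemma isReciprocalOff_ofExp {n : ℕ} {p : Rn n → ℝ} (hpm : Measurable p) (hp : ∀ x, 1 ≤ p x) :
    IsReciprocalOff ∅ (ofExp p) fun x => 1 / p x where
  measurableSet := MeasurableSet.empty
  measurable := ENNReal.measurable_ofReal.comp hpm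
  eq_zero x hx := hx.elim
  eq_inv x _ := by
    have : 0 < p x := by linarith [hp x]
    rw [ofExp, one_div, ENNReal.ofReal_inv_of_pos this, inv_inv]
  nonneg x := one_div_nonneg.2 (by linarith [hp x])
  le_one x := (div_le_one (by linarith [hp x])).2 (hp x)

lemma measurable_econj : Measurable econj := by
  refine Measurable.ite (measurableSet_singleton 1) measurable_const
    (Measurable.ite (measurableSet_singleton ∞) measurable_const ?_)
  fun_prop

lemma isReciprocalOff_conjExp {n : ℕ} {p : Rn n → ℝ} (hpm : Measurable p) (hp : ∀ x, 0 < p x) :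
    IsReciprocalOff {x | p x < 1} (conjExp p) fun x => max 0 (1 - 1 / p x) where
  measurableSet := measurableSet_lt hpm measurable_const
  measurable := measurable_econj.comp (ENNReal.measurable_ofReal.comp hpm)
  eq_zero x hx := by
    have hx : p x < 1 := hx
    rw [conjExp, econj, if_neg (by simpa using hx.ne), if_neg ofReal_ne_top,
      ENNReal.toReal_ofReal (hp x).le, ENNReal.ofReal_eq_zero]
    exact div_nonpos_of_nonneg_of_nonpos (hp x).le (by linarith)
  eq_inv x hx := by
    have hx : 1 ≤ p x := not_lt.1 hx
    rcases hx.eq_or_lt with h | h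
    · simp [conjExp, econj, ← h]
    · have hpos : 0 < 1 - 1 / p x := sub_pos.2 ((div_lt_one (hp x)).2 h)
      rw [conjExp, econj, if_neg (by simpa using h.ne'), if_neg ofReal_ne_top,
        ENNReal.toReal_ofReal (hp x).le, max_eq_right hpos.le, ← ENNReal.ofReal_inv_of_pos hpos]
      congr 1
      have := (hp x).ne'
      field_simp
  nonneg x := le_max_left _ _
  le_one x := max_le zero_le_one (by linarith [one_div_pos.2 (hp x)])

lemma LH.hasTailOscillation {n : ℕ} {p : Rn n → ℝ} (hp : LH p) :
    HasTailOscillation fun x => 1 / p x :=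
  fun _ hB => hp.exists_mul_abs_log_le hB

lemma HasTailOscillation.max_zero_one_sub_add {n : ℕ} {s t : Rn n → ℝ}
    (hs : HasTailOscillation s) (ht : HasTailOscillation t) :
    HasTailOscillation fun x => max 0 (1 - (s x + t x)) := by
  intro B hB
  obtain ⟨K, hK⟩ := hs B hB
  obtain ⟨L, hL⟩ := ht B hB
  refine ⟨K + L, fun Q x y hx hy m hm hmQ hmB => ?_⟩
  have hmax : |max 0 (1 - (s x + t x)) - max 0 (1 - (s y + t y))| ≤
      |s x - s y| + |t x - t y| := by
    calc _ ≤ |(1 - (s x + t x)) - (1 - (s y + t y))| := by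
          simpa using abs_max_sub_max_le_max 0 (1 - (s x + t x)) 0 (1 - (s y + t y))
      _ = |-((s x - s y) + (t x - t y))| := by congr 1; ring
      _ ≤ _ := by
        rw [abs_neg]
        exact abs_add_le _ _
  calc _ ≤ (|s x - s y| + |t x - t y|) * |Real.log m| := by gcongr
    _ ≤ K + L := by
      rw [add_mul]
      exact add_le_add (hK Q x y hx hy m hm hmQ hmB) (hL Q x y hx hy m hm hmQ hmB)

/-- the summation condition `G⃗` holds for log-Hölder continuous
exponents. -/
theorem statement8 {n : ℕ} (p₁ p₂ p : Rn n → ℝ)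
    (hp₁m : Measurable p₁) (hp₂m : Measurable p₂)
    (hp₁1 : ∀ x, 1 ≤ p₁ x) (hp₂1 : ∀ x, 1 ≤ p₂ x)
    (hp₁LH : LH p₁) (hp₂LH : LH p₂)
    (hp : ∀ x, 1 / p x = 1 / p₁ x + 1 / p₂ x) :
    ∃ C : ℝ≥0∞, C ≠ ∞ ∧ ∀ 𝒬 : Set (Cube n),
      𝒬.PairwiseDisjoint (fun Q => Q.toSet) →
      ∀ f₁ f₂ h : Rn n → ℝ, Measurable f₁ → Measurable f₂ → Measurable h →
        vNorm (ofExp p₁) f₁ ≠ ∞ → vNorm (ofExp p₂) f₂ ≠ ∞ →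
        vNorm (conjExp p) h ≠ ∞ →
        (∑' Q : 𝒬,
            vNorm (ofExp p₁) ((Q : Cube n).toSet.indicator f₁) *
              vNorm (ofExp p₂) ((Q : Cube n).toSet.indicator f₂) *
                vNorm (conjExp p) ((Q : Cube n).toSet.indicator h)) ≤
          C * vNorm (ofExp p₁) f₁ * vNorm (ofExp p₂) f₂ * vNorm (conjExp p) h := by
  have hppos : ∀ x, 0 < p x := by
    intro x
    rw [← one_div_pos, hp x]
    have h1 := hp₁1 x
    have h2 := hp₂1 x
    positivity
  have hpm : Measurable p := by
    have : p = fun x => (1 / p₁ x + 1 / p₂ x)⁻¹ := by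
      ext x
      rw [← hp x, one_div, inv_inv]
    rw [this]
    fun_prop
  have hr₃ := isReciprocalOff_conjExp hpm hppos
  rcases lt_or_ge (volume {x | p x < 1}) 1 with hE | hE
  · have h1 : ∀ x, 1 / p₁ x ≤ 1 := fun x =>
      (div_le_one (by linarith [hp₁1 x])).2 (hp₁1 x)
    have h2 : ∀ x, 1 / p₂ x ≤ 1 := fun x =>
      (div_le_one (by linarith [hp₂1 x])).2 (hp₂1 x)
    have hs₃ : HasTailOscillation fun x => max 0 (1 - 1 / p x) := by
      simp only [hp]
      exact hp₁LH.hasTailOscillation.max_zero_one_sub_add hp₂LH.hasTailOscillation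
    obtain ⟨C, hC, H⟩ := exists_tsum_vNorm_indicator_le (isReciprocalOff_ofExp hp₁m hp₁1)
      (isReciprocalOff_ofExp hp₂m hp₂1) hr₃ (by simp) (by simp) hE hp₁LH.hasTailOscillation
      hp₂LH.hasTailOscillation hs₃
      (fun x => by linarith [le_max_right 0 (1 - 1 / p x), hp x])
      (fun x => by
        rcases max_choice 0 (1 - 1 / p x) with h | h <;> rw [h] <;>
          linarith [hp x, h1 x, h2 x])
    exact ⟨C, hC, fun 𝒬 h𝒬 f₁ f₂ h _ _ _ => H 𝒬 h𝒬 f₁ f₂ h⟩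
  · refine ⟨1, one_ne_top, fun 𝒬 _ f₁ f₂ h _ _ hh _ _ hn => ?_⟩
    have hzero : ∀ S : Set (Rn n), vNorm (conjExp p) (S.indicator h) = 0 := fun S => by
      rw [vNorm, ofReal_abs_indicator]
      exact hr₃.eNorm_indicator_eq_zero hE (by fun_prop) hn S
    simp [hzero]
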